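/- Assume n ≥ 1, α_n ≠ 0 and α_{n+1} ≠ 0. Then there exists t ∈ ℂ such that Ω_n(z) - z Θ_n(z) = -b q^{n+1} z² + t z - conj(b) q^n, i.e. the quadratic polynomial Ω_n(z) - z Θ_n(z) has leading coefficient -b q^{n+1} and constant term -conj(b) q^n. -/

import Mathlib

open Complex MeasureTheory

/-- The `q`-Gamma weight
`w(z) = ∏_{i=0}^∞ (1 - a z q^i)(1 - conj(a) z⁻¹ q^i) / ∏_{i=0}^∞ (1 - b z q^i)(1 - conj(b) z⁻¹ q^i)`. -/
noncomputable def qGammaWeight (q : ℝ) (a b : ℂ) (z : ℂ) : ℂ :=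
  ((∏' i : ℕ, (1 - a * z * (q : ℂ) ^ i)) *
      (∏' i : ℕ, (1 - (starRingEnd ℂ) a * z⁻¹ * (q : ℂ) ^ i))) /
    ((∏' i : ℕ, (1 - b * z * (q : ℂ) ^ i)) *
      (∏' i : ℕ, (1 - (starRingEnd ℂ) b * z⁻¹ * (q : ℂ) ^ i)))

/-- `V(z) = (qz - conj a)(1 - bz)`. -/
noncomputable def Vq (q : ℝ) (a b : ℂ) (z : ℂ) : ℂ :=
  ((q : ℂ) * z - (starRingEnd ℂ) a) * (1 - b * z)

/-- `W(z) = (qz - conj b)(1 - az)`. -/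
noncomputable def Wq (q : ℝ) (a b : ℂ) (z : ℂ) : ℂ :=
  ((q : ℂ) * z - (starRingEnd ℂ) b) * (1 - a * z)

/-- Integration against the measure `dμ(θ) = w(e^{iθ}) dθ` on `[0, 2π]`. -/
noncomputable def wInt (w : ℂ → ℂ) (f : ℝ → ℂ) : ℂ :=
  ∫ θ in (0 : ℝ)..(2 * Real.pi), f θ * w (Complex.exp (θ * Complex.I))

/-- `σ_n = ∫ |φ_n|² dμ`, written as `∫ conj(φ_n) φ_n dμ`. -/
noncomputable def sigmaW (w : ℂ → ℂ) (φ : ℕ → Polynomial ℂ) (n : ℕ) : ℂ :=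
  wInt w (fun θ => (starRingEnd ℂ) ((φ n).eval (Complex.exp (θ * Complex.I))) *
    (φ n).eval (Complex.exp (θ * Complex.I)))

/-- `ε_n(z) = ∫ (e^{iθ}+z)/(e^{iθ}-z) φ_n(e^{iθ}) dμ(θ)`. -/
noncomputable def epsW (w : ℂ → ℂ) (φ : ℕ → Polynomial ℂ) (n : ℕ) (z : ℂ) : ℂ :=
  wInt w (fun θ => ((Complex.exp (θ * Complex.I) + z) / (Complex.exp (θ * Complex.I) - z)) *
    (φ n).eval (Complex.exp (θ * Complex.I)))

/-- `φ_n*(z) = z^n conj(φ_n(1/conj z))`, the reversed polynomial. -/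
noncomputable def phiStarW (φ : ℕ → Polynomial ℂ) (n : ℕ) (z : ℂ) : ℂ :=
  z ^ n * (starRingEnd ℂ) ((φ n).eval ((starRingEnd ℂ) z)⁻¹)

open Filter Topology in
lemma qP_cont (q : ℝ) (hq : q ∈ Set.Ioo (0 : ℝ) 1) :
    Continuous (fun x : ℂ => ∏' i : ℕ, (1 - x * (q : ℂ) ^ i)) := by
  rw [continuous_iff_continuousAt]
  intro x
  have := tendsto_tprod_one_add_of_dominated_convergence (𝓕 := 𝓝 x)
    (f := fun (y : ℂ) (i : ℕ) => - (y * (q : ℂ) ^ i)) (g := fun i => - (x * (q : ℂ) ^ i))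
    (bound := fun i => (‖x‖ + 1) * q ^ i)
    ((summable_geometric_of_lt_one hq.1.le hq.2).mul_left _)
    (fun i => (Continuous.tendsto (by fun_prop) x)) ?_
  · simpa [ContinuousAt, sub_eq_add_neg] using this
  · have h : ∀ᶠ y in 𝓝 x, ‖y‖ < ‖x‖ + 1 :=
      (continuous_norm.tendsto x).eventually (gt_mem_nhds (by linarith))
    filter_upwards [h] with y hy i
    rw [norm_neg, norm_mul, norm_pow, Complex.norm_real, Real.norm_of_nonneg hq.1.le]
    exact mul_le_mul_of_nonneg_right hy.le (pow_nonneg hq.1.le _)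

lemma qP_summable (q : ℝ) (hq : q ∈ Set.Ioo (0 : ℝ) 1) (x : ℂ) :
    Summable (fun i : ℕ => ‖- (x * (q : ℂ) ^ i)‖) := by
  simp only [norm_neg, norm_mul, norm_pow, Complex.norm_real, Real.norm_of_nonneg hq.1.le]
  exact (summable_geometric_of_lt_one hq.1.le hq.2).mul_left _

lemma qP_ne_zero (q : ℝ) (hq : q ∈ Set.Ioo (0 : ℝ) 1) (x : ℂ) (hx : ‖x‖ < 1) :
    (∏' i : ℕ, (1 - x * (q : ℂ) ^ i)) ≠ 0 := by
  simp only [sub_eq_add_neg]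
  refine tprod_one_add_ne_zero_of_summable (fun i h => ?_) (qP_summable q hq x)
  have h1 : x * (q : ℂ) ^ i = 1 := by linear_combination -h
  have h2 : ‖x * (q : ℂ) ^ i‖ < 1 := by
    rw [norm_mul, norm_pow, Complex.norm_real, Real.norm_of_nonneg hq.1.le]
    exact mul_lt_one_of_nonneg_of_lt_one_left (norm_nonneg _) hx
      (pow_le_one₀ hq.1.le hq.2.le)
  rw [h1] at h2
  simp at h2

lemma qP_conj (q : ℝ) (hq : q ∈ Set.Ioo (0 : ℝ) 1) (x : ℂ) :
    (∏' i : ℕ, (1 - (starRingEnd ℂ) x * (q : ℂ) ^ i)) =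
      (starRingEnd ℂ) (∏' i : ℕ, (1 - x * (q : ℂ) ^ i)) := by
  have := (multipliable_one_add_of_summable (qP_summable q hq x)).map_tprod
    (starRingEnd ℂ) Complex.continuous_conj
  simpa [sub_eq_add_neg] using this.symm

lemma weight_circle (q : ℝ) (hq : q ∈ Set.Ioo (0 : ℝ) 1) (a b : ℂ) (ha1 : ‖a‖ < 1)
    (hb1 : ‖b‖ < 1) : ∃ v : ℝ → ℝ, Continuous v ∧ (∀ θ, 0 < v θ) ∧
      ∀ θ : ℝ, qGammaWeight q a b (Complex.exp (θ * Complex.I)) = (v θ : ℂ) := by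
  have hn : ∀ (c : ℂ) (θ : ℝ), ‖c‖ < 1 → ‖c * Complex.exp (θ * Complex.I)‖ < 1 := by
    intro c θ hc
    rwa [norm_mul, Complex.norm_exp_ofReal_mul_I, mul_one]
  have hc : ∀ (c : ℂ) (θ : ℝ), (starRingEnd ℂ) c * (Complex.exp (θ * Complex.I))⁻¹ =
      (starRingEnd ℂ) (c * Complex.exp (θ * Complex.I)) := by
    intro c θ
    rw [map_mul, ← Complex.exp_conj, ← Complex.exp_neg]
    simp
  refine ⟨fun θ => Complex.normSq (∏' i : ℕ, (1 - (a * Complex.exp (θ * Complex.I)) * (q : ℂ) ^ i)) /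
    Complex.normSq (∏' i : ℕ, (1 - (b * Complex.exp (θ * Complex.I)) * (q : ℂ) ^ i)), ?_, ?_, ?_⟩
  · refine Continuous.div ?_ ?_ ?_
    · exact Complex.continuous_normSq.comp ((qP_cont q hq).comp (by fun_prop))
    · exact Complex.continuous_normSq.comp ((qP_cont q hq).comp (by fun_prop))
    · intro θ
      exact (Complex.normSq_pos.2 (qP_ne_zero q hq _ (hn b θ hb1))).ne'
  · intro θ
    exact div_pos (Complex.normSq_pos.2 (qP_ne_zero q hq _ (hn a θ ha1)))
      (Complex.normSq_pos.2 (qP_ne_zero q hq _ (hn b θ hb1)))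
  · intro θ
    unfold qGammaWeight
    rw [hc a, hc b, qP_conj q hq, qP_conj q hq, Complex.mul_conj, Complex.mul_conj]
    push_cast
    rfl

lemma exp_neg_nat (k : ℕ) (θ : ℝ) :
    Complex.exp (-(k : ℂ) * θ * Complex.I) = (Complex.exp (θ * Complex.I))⁻¹ ^ k := by
  rw [← Complex.exp_neg, ← Complex.exp_nat_mul]
  congr 1
  ring

lemma exists_circle_ne_zero (p : Polynomial ℂ) (hp : p ≠ 0) :
    ∃ c ∈ Set.Icc (0 : ℝ) (2 * Real.pi), p.eval (Complex.exp (c * Complex.I)) ≠ 0 := by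
  by_contra! h
  apply hp
  have hinj : Set.InjOn (circleMap 0 1) (Set.Ioc (0 : ℝ) (2 * Real.pi)) := by
    have := injOn_circleMap_of_abs_sub_le (a := 0) (b := 2 * Real.pi) (R := 1) (c := 0)
      one_ne_zero (by rw [zero_sub, abs_neg, abs_of_pos Real.two_pi_pos])
    rwa [Set.uIoc_of_le Real.two_pi_pos.le] at this
  refine Polynomial.eq_zero_of_infinite_isRoot p
    (Set.Infinite.mono ?_ ((Set.Ioc_infinite Real.two_pi_pos).image hinj))
  rintro _ ⟨θ, hθ, rfl⟩
  have := h θ ⟨hθ.1.le, hθ.2⟩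
  simpa [circleMap, Polynomial.IsRoot] using this

lemma sigma_ne_zero (w : ℂ → ℂ) (v : ℝ → ℝ) (hv : Continuous v) (hpos : ∀ θ, 0 < v θ)
    (hw : ∀ θ : ℝ, w (Complex.exp (θ * Complex.I)) = (v θ : ℂ)) (φ : ℕ → Polynomial ℂ)
    (n : ℕ) (hφ : φ n ≠ 0) : sigmaW w φ n ≠ 0 := by
  have h1 : sigmaW w φ n = ((∫ θ in (0 : ℝ)..(2 * Real.pi),
      Complex.normSq ((φ n).eval (Complex.exp (θ * Complex.I))) * v θ : ℝ) : ℂ) := by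
    unfold sigmaW wInt
    rw [← intervalIntegral.integral_ofReal]
    congr 1
    funext θ
    beta_reduce
    rw [hw, mul_comm ((starRingEnd ℂ) _), Complex.mul_conj]
    push_cast
    rfl
  rw [h1, Complex.ofReal_ne_zero]
  apply ne_of_gt
  refine intervalIntegral.integral_pos Real.two_pi_pos ?_ ?_ ?_
  · refine Continuous.continuousOn (Continuous.mul ?_ hv)
    exact Complex.continuous_normSq.comp ((φ n).continuous.comp (by fun_prop))
  · intro θ _
    exact mul_nonneg (Complex.normSq_nonneg _) (hpos θ).le
  · obtain ⟨c, hc, h⟩ := exists_circle_ne_zero (φ n) hφ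
    exact ⟨c, hc, mul_pos (Complex.normSq_pos.2 h) (hpos c)⟩

lemma sigma_eq (w : ℂ → ℂ) (hwc : Continuous fun θ : ℝ => w (Complex.exp (θ * Complex.I)))
    (φ : ℕ → Polynomial ℂ) (n : ℕ) (hmonic : (φ n).Monic) (hdeg : (φ n).natDegree = n)
    (horth : ∀ k < n, wInt w (fun θ => (φ n).eval (Complex.exp (θ * Complex.I)) *
        Complex.exp (-(k : ℂ) * θ * Complex.I)) = 0) :
    sigmaW w φ n = wInt w (fun θ => (φ n).eval (Complex.exp (θ * Complex.I)) *
        Complex.exp (-(n : ℂ) * θ * Complex.I)) := by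
  have hp : Continuous fun θ : ℝ => (φ n).eval (Complex.exp (θ * Complex.I)) :=
    (φ n).continuous.comp (by fun_prop)
  have h1 : sigmaW w φ n = ∑ k ∈ Finset.range (n + 1), (starRingEnd ℂ) ((φ n).coeff k) *
      wInt w (fun θ => (φ n).eval (Complex.exp (θ * Complex.I)) *
        Complex.exp (-(k : ℂ) * θ * Complex.I)) := by
    unfold sigmaW wInt
    simp only [← intervalIntegral.integral_const_mul]
    rw [← intervalIntegral.integral_finsetSum]
    · congr 1
      funext θ
      have h2 : (starRingEnd ℂ) ((φ n).eval (Complex.exp (θ * Complex.I))) =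
          ∑ k ∈ Finset.range (n + 1), (starRingEnd ℂ) ((φ n).coeff k) *
            Complex.exp (-(k : ℂ) * θ * Complex.I) := by
        rw [Polynomial.eval_eq_sum_range, hdeg, map_sum]
        refine Finset.sum_congr rfl fun k _ => ?_
        rw [exp_neg_nat, map_mul, map_pow, ← Complex.exp_conj, ← Complex.exp_neg]
        simp
      rw [h2, Finset.sum_mul, Finset.sum_mul]
      refine Finset.sum_congr rfl fun k _ => ?_
      ring
    · intro k _
      apply Continuous.intervalIntegrable
      exact continuous_const.mul ((hp.mul (by fun_prop)).mul hwc)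
  rw [h1, Finset.sum_range_succ, Finset.sum_eq_zero, zero_add]
  · have : (φ n).coeff n = 1 := by
      have := hmonic.coeff_natDegree
      rwa [hdeg] at this
    rw [this, map_one, one_mul]
  · intro k hk
    rw [horth k (Finset.mem_range.1 hk), mul_zero]

/-- The tail integral. -/
noncomputable def tailG (w : ℂ → ℂ) (p : Polynomial ℂ) (n : ℕ) (z : ℂ) : ℂ :=
  wInt w (fun θ => (p.eval (Complex.exp (θ * Complex.I)) *
    Complex.exp (-(n : ℂ) * θ * Complex.I)) *
      (Complex.exp (θ * Complex.I) / (Complex.exp (θ * Complex.I) - z)))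

lemma circle_sub_ne (z : ℂ) (hz : ‖z‖ < 1) (θ : ℝ) : Complex.exp (θ * Complex.I) - z ≠ 0 := by
  intro h
  rw [sub_eq_zero] at h
  rw [← h, Complex.norm_exp_ofReal_mul_I] at hz
  exact lt_irrefl _ hz

lemma kernel_identity (e z : ℂ) (n : ℕ) (he : e ≠ 0) (h : e - z ≠ 0) :
    (e + z) / (e - z) = -1 + ∑ k ∈ Finset.range n, 2 * z ^ k * e⁻¹ ^ k
      + 2 * z ^ n * (e⁻¹ ^ n * (e / (e - z))) := by
  induction n with
  | zero =>
    simp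
    field_simp
    ring
  | succ m ih =>
    rw [ih, Finset.sum_range_succ]
    have : e / (e - z) = 1 + z * e⁻¹ * (e / (e - z)) := by
      field_simp
      ring
    rw [pow_succ, pow_succ]
    linear_combination (2 * z ^ m * e⁻¹ ^ m) * this

lemma eps_eq (w : ℂ → ℂ) (hwc : Continuous fun θ : ℝ => w (Complex.exp (θ * Complex.I)))
    (φ : ℕ → Polynomial ℂ) (n : ℕ) (hn : 1 ≤ n)
    (horth : ∀ k < n, wInt w (fun θ => (φ n).eval (Complex.exp (θ * Complex.I)) *
        Complex.exp (-(k : ℂ) * θ * Complex.I)) = 0) (z : ℂ) (hz : ‖z‖ < 1) :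
    epsW w φ n z = 2 * z ^ n * tailG w (φ n) n z := by
  have hp : Continuous fun θ : ℝ => (φ n).eval (Complex.exp (θ * Complex.I)) :=
    (φ n).continuous.comp (by fun_prop)
  have hcont : ∀ k : ℕ, Continuous fun θ : ℝ => (φ n).eval (Complex.exp (θ * Complex.I)) *
        Complex.exp (-(k : ℂ) * θ * Complex.I) * w (Complex.exp (θ * Complex.I)) :=
    fun k => (hp.mul (by fun_prop)).mul hwc
  have hker : Continuous fun θ : ℝ =>
      Complex.exp (θ * Complex.I) / (Complex.exp (θ * Complex.I) - z) :=
    Continuous.div (by fun_prop) (by fun_prop) (circle_sub_ne z hz)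
  have h1 : epsW w φ n z = (-1) * wInt w (fun θ => (φ n).eval (Complex.exp (θ * Complex.I)) *
        Complex.exp (-((0 : ℕ) : ℂ) * θ * Complex.I)) +
      ∑ k ∈ Finset.range n, (2 * z ^ k) *
      wInt w (fun θ => (φ n).eval (Complex.exp (θ * Complex.I)) *
        Complex.exp (-(k : ℂ) * θ * Complex.I)) + 2 * z ^ n * tailG w (φ n) n z := by
    unfold epsW tailG wInt
    simp only [← intervalIntegral.integral_const_mul]
    rw [← intervalIntegral.integral_finsetSum, ← intervalIntegral.integral_add,
      ← intervalIntegral.integral_add]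
    · congr 1
      funext θ
      rw [kernel_identity _ z n (Complex.exp_ne_zero _) (circle_sub_ne z hz θ), exp_neg_nat n,
        add_mul, add_mul, add_mul, add_mul, Finset.sum_mul, Finset.sum_mul]
      congr 1
      · congr 1
        · simp
        · refine Finset.sum_congr rfl fun k _ => ?_
          rw [exp_neg_nat k]
          ring
      · ring
    · apply Continuous.intervalIntegrable
      exact (continuous_const.mul (hcont 0)).add
        (continuous_finsetSum _ fun k _ => continuous_const.mul (hcont k))
    · apply Continuous.intervalIntegrable
      exact continuous_const.mul (((hp.mul (by fun_prop)).mul hker).mul hwc)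
    · apply Continuous.intervalIntegrable
      exact continuous_const.mul (hcont 0)
    · apply Continuous.intervalIntegrable
      exact (continuous_finsetSum _ fun k _ => continuous_const.mul (hcont k))
    · intro k _
      apply Continuous.intervalIntegrable
      exact continuous_const.mul (hcont k)
  rw [h1, horth 0 hn, Finset.sum_eq_zero, mul_zero, zero_add, zero_add]
  intro k hk
  rw [horth k (Finset.mem_range.1 hk), mul_zero]

open Filter Topology in
lemma tailG_tendsto (w : ℂ → ℂ) (hwc : Continuous fun θ : ℝ => w (Complex.exp (θ * Complex.I)))
    (p : Polynomial ℂ) (n : ℕ) :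
    Tendsto (tailG w p n) (𝓝 0) (𝓝 (wInt w (fun θ => p.eval (Complex.exp (θ * Complex.I)) *
        Complex.exp (-(n : ℂ) * θ * Complex.I)))) := by
  have hp : Continuous fun θ : ℝ => p.eval (Complex.exp (θ * Complex.I)) :=
    p.continuous.comp (by fun_prop)
  have hcont : Continuous fun θ : ℝ => p.eval (Complex.exp (θ * Complex.I)) *
        Complex.exp (-(n : ℂ) * θ * Complex.I) * w (Complex.exp (θ * Complex.I)) :=
    (hp.mul (by fun_prop)).mul hwc
  have hsmall : ∀ᶠ z : ℂ in 𝓝 0, ‖z‖ < 1 / 2 :=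
    (continuous_norm.tendsto (0 : ℂ)).eventually (gt_mem_nhds (by norm_num))
  unfold tailG wInt
  refine intervalIntegral.tendsto_integral_filter_of_dominated_convergence
    (fun θ : ℝ => ‖p.eval (Complex.exp (θ * Complex.I)) *
        Complex.exp (-(n : ℂ) * θ * Complex.I) * w (Complex.exp (θ * Complex.I))‖ * 2) ?_ ?_ ?_ ?_
  · filter_upwards [hsmall] with z hz
    apply Continuous.aestronglyMeasurable
    refine Continuous.mul (Continuous.mul (hp.mul (by fun_prop)) ?_) hwc
    exact Continuous.div (by fun_prop) (by fun_prop) (circle_sub_ne z (by linarith))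
  · filter_upwards [hsmall] with z hz
    refine Filter.Eventually.of_forall fun θ _ => ?_
    rw [mul_right_comm, norm_mul]
    refine mul_le_mul_of_nonneg_left ?_ (norm_nonneg _)
    rw [norm_div, Complex.norm_exp_ofReal_mul_I]
    have h := norm_sub_norm_le (Complex.exp (θ * Complex.I)) z
    rw [Complex.norm_exp_ofReal_mul_I] at h
    rw [div_le_iff₀ (by linarith)]
    linarith
  · exact (hcont.norm.mul continuous_const).intervalIntegrable _ _
  · refine Filter.Eventually.of_forall fun θ _ => ?_
    have h : Tendsto (fun z : ℂ => Complex.exp (θ * Complex.I) / (Complex.exp (θ * Complex.I) - z))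
        (𝓝 0) (𝓝 1) := by
      have h0 : ContinuousAt (fun z : ℂ =>
          Complex.exp (θ * Complex.I) / (Complex.exp (θ * Complex.I) - z)) 0 :=
        ContinuousAt.div (by fun_prop) (by fun_prop) (by simp)
      have := h0.tendsto
      simpa using this
    have := (h.const_mul (p.eval (Complex.exp (θ * Complex.I)) *
        Complex.exp (-(n : ℂ) * θ * Complex.I))).mul_const (w (Complex.exp (θ * Complex.I)))
    simpa using this

/-- For the `q`-Gamma weight, the quadratic polynomial `Ω_n(z) - z Θ_n(z)` has leading
coefficient `-b q^{n+1}` and constant term `-conj(b) qⁿ`: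
`Ω_n(z) - z Θ_n(z) = -b q^{n+1} z² + t z - conj(b) qⁿ` for some `t ∈ ℂ`. -/
theorem Omega_coefficients
    (q : ℝ) (hq : q ∈ Set.Ioo (0 : ℝ) 1)
    (a b : ℂ) (ha : a ≠ 0) (hb : b ≠ 0)
    (ha1 : ‖a‖ < 1) (hb1 : ‖b‖ < 1)
    (φ : ℕ → Polynomial ℂ)
    (hmonic : ∀ n, (φ n).Monic)
    (hdeg : ∀ n, (φ n).natDegree = n)
    (horth : ∀ n, ∀ k < n, wInt (qGammaWeight q a b) (fun θ =>
      (φ n).eval (Complex.exp (θ * Complex.I)) *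
        Complex.exp (-(k : ℂ) * θ * Complex.I)) = 0)
    (n : ℕ) (hn : 1 ≤ n)
    (hαn : (φ n).eval 0 ≠ 0) (hα : (φ (n + 1)).eval 0 ≠ 0)
    (Θ : Polynomial ℂ) (hΘdeg : Θ.natDegree ≤ 1)
    (hΘeq : ∀ z : ℂ, 0 < ‖z‖ → ‖z‖ < 1 →
      2 * (φ (n + 1)).eval 0 * sigmaW (qGammaWeight q a b) φ n * z ^ n * Θ.eval z
        = Wq q a b z * epsW (qGammaWeight q a b) φ n ((q : ℂ) * z) * (φ n).eval z
          - Vq q a b z * epsW (qGammaWeight q a b) φ n z * (φ n).eval ((q : ℂ) * z))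
    (Ω : Polynomial ℂ) (hΩdeg : Ω.natDegree ≤ 2)
    (hΩeq : ∀ z : ℂ, Ω.eval z * (φ n).eval z
      = (φ (n + 1)).eval z * Θ.eval z + Vq q a b z * (φ n).eval ((q : ℂ) * z)) :
    ∃ t : ℂ, ∀ z : ℂ,
      Ω.eval z - z * Θ.eval z
        = -b * (q : ℂ) ^ (n + 1) * z ^ 2 + t * z - (starRingEnd ℂ) b * (q : ℂ) ^ n := by
  obtain ⟨v, hv, hvpos, hw⟩ := weight_circle q hq a b ha1 hb1
  have hwc : Continuous fun θ : ℝ => qGammaWeight q a b (Complex.exp (θ * Complex.I)) := by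
    simp only [hw]
    exact Complex.continuous_ofReal.comp hv
  have hσ := sigma_ne_zero _ v hv hvpos hw φ n (hmonic n).ne_zero
  have hG := tailG_tendsto _ hwc (φ n) n
  rw [← sigma_eq _ hwc φ n (hmonic n) (hdeg n) (horth n)] at hG
  have hε := eps_eq _ hwc φ n hn (horth n)
  generalize sigmaW (qGammaWeight q a b) φ n = σ at *
  generalize tailG (qGammaWeight q a b) (φ n) n = G at *
  have hqz : Filter.Tendsto (fun z : ℂ => (q : ℂ) * z) (nhds 0) (nhds 0) := by
    have : Continuous fun z : ℂ => (q : ℂ) * z := by fun_prop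
    simpa using this.tendsto 0
  have hcp : ∀ p : Polynomial ℂ, Filter.Tendsto (fun z : ℂ => p.eval z) (nhds 0)
      (nhds (p.eval 0)) := fun p => p.continuous.tendsto 0
  have hW : Filter.Tendsto (fun z : ℂ => Wq q a b z) (nhds 0) (nhds (-(starRingEnd ℂ) b)) := by
    have : Continuous fun z : ℂ => Wq q a b z := by unfold Wq; fun_prop
    simpa [Wq] using this.tendsto 0
  have hV : Filter.Tendsto (fun z : ℂ => Vq q a b z) (nhds 0) (nhds (-(starRingEnd ℂ) a)) := by
    have : Continuous fun z : ℂ => Vq q a b z := by unfold Vq; fun_prop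
    simpa [Vq] using this.tendsto 0
  -- the value of `Θ` at zero
  have hΘ0 : 2 * (φ (n + 1)).eval 0 * σ * Θ.eval 0 =
      -(starRingEnd ℂ) b * (2 * (q : ℂ) ^ n * σ) * (φ n).eval 0
        - -(starRingEnd ℂ) a * (2 * σ) * (φ n).eval 0 := by
    have hl : Filter.Tendsto (fun z : ℂ => 2 * (φ (n + 1)).eval 0 * σ * Θ.eval z)
        (nhdsWithin 0 {0}ᶜ) (nhds (2 * (φ (n + 1)).eval 0 * σ * Θ.eval 0)) :=
      ((hcp Θ).const_mul _).mono_left nhdsWithin_le_nhds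
    have hr : Filter.Tendsto (fun z : ℂ =>
        Wq q a b z * (2 * (q : ℂ) ^ n * G ((q : ℂ) * z)) * (φ n).eval z
        - Vq q a b z * (2 * G z) * (φ n).eval ((q : ℂ) * z))
        (nhdsWithin 0 {0}ᶜ) (nhds (-(starRingEnd ℂ) b * (2 * (q : ℂ) ^ n * σ) * (φ n).eval 0
        - -(starRingEnd ℂ) a * (2 * σ) * (φ n).eval 0)) :=
      (((hW.mul ((hG.comp hqz).const_mul _)).mul (hcp (φ n))).sub
        ((hV.mul (hG.const_mul _)).mul ((hcp (φ n)).comp hqz))).mono_left nhdsWithin_le_nhds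
    refine tendsto_nhds_unique (hl.congr' ?_) hr
    have hsmall : ∀ᶠ z : ℂ in nhds 0, ‖z‖ < 1 :=
      (continuous_norm.tendsto (0 : ℂ)).eventually (gt_mem_nhds (by norm_num))
    filter_upwards [self_mem_nhdsWithin, nhdsWithin_le_nhds hsmall] with z hz0 hz1
    have hz0' : z ≠ 0 := hz0
    have h := hΘeq z (norm_pos_iff.2 hz0') hz1
    have hq1 : ‖(q : ℂ) * z‖ < 1 := by
      rw [norm_mul, Complex.norm_real, Real.norm_of_nonneg hq.1.le]
      exact mul_lt_one_of_nonneg_of_lt_one_left hq.1.le hq.2 hz1.le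
    rw [hε z hz1, hε _ hq1, mul_pow] at h
    apply mul_left_cancel₀ (pow_ne_zero n hz0')
    linear_combination h
  -- the value of `Ω` at zero
  have hΩ0 : Ω.eval 0 = -(starRingEnd ℂ) b * (q : ℂ) ^ n := by
    have h := hΩeq 0
    have hV0 : Vq q a b 0 = -(starRingEnd ℂ) a := by simp [Vq]
    rw [hV0, mul_zero] at h
    apply mul_right_cancel₀ hαn
    apply mul_left_cancel₀ (mul_ne_zero two_ne_zero hσ)
    linear_combination (2 * σ) * h + hΘ0
  -- polynomial form
  have hpoly : Ω * φ n = φ (n + 1) * Θ +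
      (Polynomial.C (q : ℂ) * Polynomial.X - Polynomial.C ((starRingEnd ℂ) a)) *
        (1 - Polynomial.C b * Polynomial.X) *
        (φ n).comp (Polynomial.C (q : ℂ) * Polynomial.X) := by
    apply Polynomial.funext
    intro z
    simp only [Polynomial.eval_mul, Polynomial.eval_add, Polynomial.eval_sub, Polynomial.eval_C,
      Polynomial.eval_X, Polynomial.eval_one, Polynomial.eval_comp]
    exact hΩeq z
  have hlead : ∀ m, (φ m).coeff m = 1 := fun m => by
    have := (hmonic m).coeff_natDegree
    rwa [hdeg] at this
  have hd1 : (Polynomial.C (q : ℂ) * Polynomial.X - Polynomial.C ((starRingEnd ℂ) a)).natDegree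
      ≤ 1 := by compute_degree
  have hd2 : (1 - Polynomial.C b * Polynomial.X).natDegree ≤ 1 := by compute_degree
  have hd3 : ((φ n).comp (Polynomial.C (q : ℂ) * Polynomial.X)).natDegree ≤ n := by
    refine Polynomial.natDegree_comp_le.trans ?_
    rw [hdeg]
    calc n * _ ≤ n * 1 := Nat.mul_le_mul_left _ (by compute_degree)
      _ = n := mul_one n
  have hc3 : ((φ n).comp (Polynomial.C (q : ℂ) * Polynomial.X)).coeff n = (q : ℂ) ^ n := by
    rw [Polynomial.comp_C_mul_X_coeff, hlead, one_mul]
  have hΩ2 : Ω.coeff 2 - Θ.coeff 1 = -b * (q : ℂ) ^ (n + 1) := by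
    have h := congrArg (fun p => Polynomial.coeff p (1 + 1 + n)) hpoly
    simp only [Polynomial.coeff_add] at h
    rw [Polynomial.coeff_mul_add_eq_of_natDegree_le (df := 1 + 1) (dg := n) hΩdeg (hdeg n).le,
      Polynomial.coeff_mul_add_eq_of_natDegree_le (df := 1 + 1) (dg := n)
        (Polynomial.natDegree_mul_le_of_le hd1 hd2) hd3,
      Polynomial.coeff_mul_add_eq_of_natDegree_le hd1 hd2, hc3,
      show 1 + 1 + n = (n + 1) + 1 by ring,
      Polynomial.coeff_mul_add_eq_of_natDegree_le (hdeg (n + 1)).le hΘdeg, hlead, hlead] at h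
    simp [Polynomial.coeff_one, Polynomial.coeff_C] at h
    rw [h]
    ring
  refine ⟨Ω.coeff 1 - Θ.coeff 0, fun z => ?_⟩
  have e1 : Ω.eval z = Ω.coeff 0 + Ω.coeff 1 * z + Ω.coeff 2 * z ^ 2 := by
    rw [Polynomial.eval_eq_sum_range' (Nat.lt_succ_of_le hΩdeg)]
    simp [Finset.sum_range_succ]
  have e2 : Θ.eval z = Θ.coeff 0 + Θ.coeff 1 * z := by
    rw [Polynomial.eval_eq_sum_range' (Nat.lt_succ_of_le hΘdeg)]
    simp [Finset.sum_range_succ]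
  rw [← Polynomial.coeff_zero_eq_eval_zero] at hΩ0
  rw [e1, e2]
  linear_combination hΩ0 + z ^ 2 * hΩ2
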